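/- Suppose φ is a parabolic automorphism of the unit disc with fixed point a on the unit circle, u is continuous on the closed disc, analytic on the open disc, bounded away from zero, and uC_φ is invertible on the Bloch space. Then the spectral radius of uC_φ on the Bloch space equals |u(a)|. -/

import Mathlib

open Complex Metric Set Filter MeasureTheory Finset

noncomputable section

/-- The open unit disc in ℂ. -/
def D1 : Set ℂ := Metric.ball 0 1

/-- Analytic (holomorphic) on the open unit disc. -/
def AnalyticOnD (f : ℂ → ℂ) : Prop := DifferentiableOn ℂ f D1

/-- Bloch seminorm. -/
def blochSemi (f : ℂ → ℂ) : ℝ := ⨆ z : D1, (1 - ‖(z : ℂ)‖ ^ 2) * ‖deriv f (z : ℂ)‖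

/-- Bloch norm. -/
def blochNorm (f : ℂ → ℂ) : ℝ := ‖f 0‖ + blochSemi f

/-- Membership in the Bloch space. -/
def InBloch (f : ℂ → ℂ) : Prop :=
  AnalyticOnD f ∧ ∃ C, ∀ z ∈ D1, (1 - ‖z‖ ^ 2) * ‖deriv f z‖ ≤ C

/-- Sup norm over the unit disc. -/
def supNormD (f : ℂ → ℂ) : ℝ := ⨆ z : D1, ‖f (z : ℂ)‖

/-- Weighted composition operator uC_φ. -/
def wco (u φ : ℂ → ℂ) (f : ℂ → ℂ) : ℂ → ℂ := fun z => u z * f (φ z)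

/-- Multiplication operator M_u. -/
def mult (u : ℂ → ℂ) (f : ℂ → ℂ) : ℂ → ℂ := fun z => u z * f z

/-- The weight u_{(n)} = ∏_{j=0}^{n-1} u ∘ φ_j. -/
def wprod (u φ : ℂ → ℂ) (n : ℕ) : ℂ → ℂ := fun z => ∏ j ∈ Finset.range n, u (φ^[j] z)

/-- Boundedness of an operator on the Bloch space. -/
def BddOnBloch (T : (ℂ → ℂ) → (ℂ → ℂ)) : Prop :=
  ∃ C, ∀ f, InBloch f → InBloch (T f) ∧ blochNorm (T f) ≤ C * blochNorm f

/-- Operator norm on the Bloch space. -/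
def opNormB (T : (ℂ → ℂ) → (ℂ → ℂ)) : ℝ :=
  sInf {C : ℝ | 0 ≤ C ∧ ∀ f, InBloch f → blochNorm (T f) ≤ C * blochNorm f}

/-- Invertibility of an operator on the Bloch space (bounded two-sided inverse). -/
def InvertibleOnBloch (T : (ℂ → ℂ) → (ℂ → ℂ)) : Prop :=
  BddOnBloch T ∧ ∃ S, BddOnBloch S ∧
    ∀ f, InBloch f → Set.EqOn (S (T f)) f D1 ∧ Set.EqOn (T (S f)) f D1

/-- Spectrum of an operator acting on the Bloch space. -/
def blochSpectrum (T : (ℂ → ℂ) → (ℂ → ℂ)) : Set ℂ :=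
  {lam | ¬ InvertibleOnBloch (fun f z => lam * f z - T f z)}

/-- Automorphism of the unit disc (Möbius form). -/
def IsDiscAuto (φ : ℂ → ℂ) : Prop :=
  ∃ lam a : ℂ, ‖lam‖ = 1 ∧ a ∈ D1 ∧ ∀ z, φ z = lam * (a - z) / (1 - (starRingEnd ℂ) a * z)

/-- Hyperbolic distance on the unit disc. -/
def hypDist (z w : ℂ) : ℝ :=
  (1 / 2) * Real.log ((1 + ‖(z - w) / (1 - (starRingEnd ℂ) z * w)‖) /
    (1 - ‖(z - w) / (1 - (starRingEnd ℂ) z * w)‖))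

/-- The disc algebra A(𝔻). -/
def InDiscAlgebra (u : ℂ → ℂ) : Prop :=
  ContinuousOn u (Metric.closedBall 0 1) ∧ AnalyticOnD u

/-- u is bounded away from zero on the unit disc. -/
def BoundedAwayFromZero (u : ℂ → ℂ) : Prop := ∃ δ > 0, ∀ z ∈ D1, δ ≤ ‖u z‖

/-- Parabolic automorphism with unique fixed point a on the unit circle (φ'(a)=1). -/
def IsParabolicAuto (φ : ℂ → ℂ) (a : ℂ) : Prop :=
  IsDiscAuto φ ∧ ‖a‖ = 1 ∧ φ a = a ∧ deriv φ a = 1 ∧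
    ∀ w, ‖w‖ ≤ 1 → φ w = w → w = a

/-- Hyperbolic automorphism with attractive fixed point a and repulsive fixed point b. -/
def IsHyperbolicAuto (φ : ℂ → ℂ) (a b : ℂ) : Prop :=
  IsDiscAuto φ ∧ ‖a‖ = 1 ∧ ‖b‖ = 1 ∧ a ≠ b ∧ φ a = a ∧ φ b = b ∧
    ∃ μ : ℝ, 0 < μ ∧ μ < 1 ∧ deriv φ a = (μ : ℂ)

/-- Square of the Dirichlet norm (normalized area measure on 𝔻). -/
def dirichletNormSq (f : ℂ → ℂ) : ℝ :=
  ‖f 0‖ ^ 2 + (1 / Real.pi) * ∫ z in D1, ‖deriv f z‖ ^ 2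

/-- Dirichlet norm. -/
def dirichletNorm (f : ℂ → ℂ) : ℝ := Real.sqrt (dirichletNormSq f)

/-- Membership in the Dirichlet space. -/
def InDirichlet (f : ℂ → ℂ) : Prop :=
  AnalyticOnD f ∧ MeasureTheory.IntegrableOn (fun z => ‖deriv f z‖ ^ 2) D1

/-- Boundedness of an operator on the Dirichlet space. -/
def BddOnDirichlet (T : (ℂ → ℂ) → (ℂ → ℂ)) : Prop :=
  ∃ C, ∀ f, InDirichlet f → InDirichlet (T f) ∧ dirichletNorm (T f) ≤ C * dirichletNorm f

/-- Operator norm on the Dirichlet space. -/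
def opNormDir (T : (ℂ → ℂ) → (ℂ → ℂ)) : ℝ :=
  sInf {C : ℝ | 0 ≤ C ∧ ∀ f, InDirichlet f → dirichletNorm (T f) ≤ C * dirichletNorm f}

/-- Invertibility of an operator on the Dirichlet space. -/
def InvertibleOnDirichlet (T : (ℂ → ℂ) → (ℂ → ℂ)) : Prop :=
  BddOnDirichlet T ∧ ∃ S, BddOnDirichlet S ∧
    ∀ f, InDirichlet f → Set.EqOn (S (T f)) f D1 ∧ Set.EqOn (T (S f)) f D1

/-- Spectrum of an operator on the Dirichlet space. -/
def dirichletSpectrum (T : (ℂ → ℂ) → (ℂ → ℂ)) : Set ℂ :=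
  {lam | ¬ InvertibleOnDirichlet (fun f z => lam * f z - T f z)}

/-- Operator norm of M_{u'} : B → H^∞_{v₁}. -/
def opNormBtoHv1 (u : ℂ → ℂ) : ℝ :=
  sInf {C : ℝ | 0 ≤ C ∧ ∀ f, InBloch f → ∀ z ∈ D1,
    (1 - ‖z‖ ^ 2) * ‖deriv u z * f z‖ ≤ C * blochNorm f}

/-- Operator norm of M_{u'} : 𝒟 → A². -/
def opNormDtoA2 (u : ℂ → ℂ) : ℝ :=
  sInf {C : ℝ | 0 ≤ C ∧ ∀ f, InDirichlet f →
    Real.sqrt ((1 / Real.pi) * ∫ z in D1, ‖deriv u z * f z‖ ^ 2) ≤ C * dirichletNorm f}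

/-- The logarithmic weight log(e/(1-|z|²)). -/
def logWeight (z : ℂ) : ℝ := Real.log (Real.exp 1 / (1 - ‖z‖ ^ 2))

/-- Characterization of multipliers of the Bloch space: u ∈ H^∞ and the log condition. -/
def MultBChar (u : ℂ → ℂ) : Prop :=
  (∃ M, ∀ z ∈ D1, ‖u z‖ ≤ M) ∧
  (∃ M, ∀ z ∈ D1, (1 - ‖z‖ ^ 2) * ‖deriv u z‖ * logWeight z ≤ M)

lemma root_tendsto (x : ℕ → ℝ) (s : ℝ) (hs : 0 < s) (hx : ∀ n, 0 ≤ x n)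
    (h1 : ∀ b, s < b → ∃ A : ℝ, ∀ n : ℕ, x n ≤ A * ((n : ℝ) + 1) ^ 2 * b ^ n)
    (h2 : ∀ b, 0 < b → b < s → ∃ c : ℝ, 0 < c ∧ ∀ n : ℕ, c * b ^ n ≤ x n) :
    Filter.Tendsto (fun n : ℕ => x n ^ ((1 : ℝ) / n)) Filter.atTop (nhds s) := by
  rw [tendsto_order]
  constructor
  · intro a' ha'
    obtain ⟨b₁, hb₁, hb₁s⟩ := exists_between (max_lt ha' hs)
    obtain ⟨b, hb, hbs⟩ := exists_between hb₁s
    have hb₁0 : 0 < b₁ := lt_of_le_of_lt (le_max_right _ _) hb₁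
    have hb0 : 0 < b := hb₁0.trans hb
    obtain ⟨c, hc, hcx⟩ := h2 b hb0 hbs
    have hlim : Tendsto (fun n : ℕ => (b₁ / b) ^ n) atTop (nhds 0) :=
      tendsto_pow_atTop_nhds_zero_of_lt_one (by positivity) ((div_lt_one hb0).2 hb)
    filter_upwards [hlim.eventually (gt_mem_nhds hc), eventually_ge_atTop 1] with n hn hn1
    have hn0 : n ≠ 0 := by omega
    have h3 : b₁ ^ n ≤ x n := by
      refine le_trans ?_ (hcx n)
      rw [div_pow, div_lt_iff₀ (by positivity)] at hn
      exact hn.le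
    calc a' ≤ max a' 0 := le_max_left _ _
      _ < b₁ := hb₁
      _ = (b₁ ^ n) ^ ((1 : ℝ) / n) := by
        rw [one_div, Real.pow_rpow_inv_natCast hb₁0.le hn0]
      _ ≤ _ := Real.rpow_le_rpow (by positivity) h3 (by positivity)
  · intro a' ha'
    obtain ⟨b₁, hb₁, hb₁s⟩ := exists_between ha'
    obtain ⟨b, hb, hbs⟩ := exists_between hb₁
    have hb0 : 0 < b := hs.trans hb
    have hb₁0 : 0 < b₁ := hs.trans hb₁
    obtain ⟨A, hA⟩ := h1 b hb
    have hr : b / b₁ < 1 := (div_lt_one hb₁0).2 hbs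
    have hr0 : 0 ≤ b / b₁ := by positivity
    have l2 := tendsto_pow_const_mul_const_pow_of_lt_one 2 hr0 hr
    have l1 := tendsto_pow_const_mul_const_pow_of_lt_one 1 hr0 hr
    have l0 := tendsto_pow_const_mul_const_pow_of_lt_one 0 hr0 hr
    have hlim : Tendsto (fun n : ℕ => A * ((n : ℝ) + 1) ^ 2 * (b / b₁) ^ n) atTop (nhds 0) := by
      have := ((l2.add (l1.const_mul 2)).add l0).const_mul A
      simp only [mul_zero, add_zero] at this
      refine this.congr fun n => ?_
      ring
    filter_upwards [hlim.eventually (gt_mem_nhds one_pos), eventually_ge_atTop 1] with n hn hn1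
    have hn0 : n ≠ 0 := by omega
    have h3 : x n ≤ b₁ ^ n := by
      refine le_trans (hA n) ?_
      rw [div_pow, ← mul_div_assoc, div_lt_iff₀ (by positivity)] at hn
      linarith
    calc x n ^ ((1 : ℝ) / n) ≤ (b₁ ^ n) ^ ((1 : ℝ) / n) :=
          Real.rpow_le_rpow (hx n) h3 (by positivity)
      _ = b₁ := by rw [one_div, Real.pow_rpow_inv_natCast hb₁0.le hn0]
      _ < a' := hb₁s

lemma card_bad (ω c : ℂ) (hc : c ≠ 0) (R : ℝ) (p : ℕ → Prop) [DecidablePred p]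
    (N : ℕ) (hN : 2 * R / ‖c‖ < N)
    (hp : ∀ j, p j → ‖ω + j * c‖ ≤ R) (n : ℕ) : #{j ∈ range n | p j} ≤ N := by
  by_cases hne : (({j ∈ range n | p j} : Finset ℕ)).Nonempty
  · set S : Finset ℕ := {j ∈ range n | p j} with hS
    set m := S.min' hne with hm
    have hsub : S ⊆ Finset.Ico m (m + N) := by
      intro j hj
      have h1 : m ≤ j := S.min'_le j hj
      have hmS : m ∈ S := S.min'_mem hne
      have pj : p j := (Finset.mem_filter.1 hj).2
      have pm : p m := (Finset.mem_filter.1 hmS).2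
      have h2 : ‖((j : ℂ) - m) * c‖ ≤ 2 * R := by
        have : ((j : ℂ) - m) * c = (ω + j * c) - (ω + m * c) := by ring
        rw [this]
        have := norm_sub_le (ω + j * c) (ω + m * c)
        linarith [hp j pj, hp m pm]
      have hcn : 0 < ‖c‖ := norm_pos_iff.2 hc
      have h3 : (j : ℂ) - m = ((j - m : ℕ) : ℂ) := by push_cast [Nat.cast_sub h1]; ring
      rw [h3, norm_mul, Complex.norm_natCast] at h2
      rw [div_lt_iff₀ hcn] at hN
      have h4 : ((j - m : ℕ) : ℝ) < N := lt_of_mul_lt_mul_right (h2.trans_lt hN) hcn.le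
      have h5 : j - m < N := by exact_mod_cast h4
      rw [Finset.mem_Ico]; omega
    simpa using Finset.card_le_card hsub
  · rw [Finset.not_nonempty_iff_eq_empty] at hne
    simp [hne]

lemma prod_upper (v : ℕ → ℝ) (M b : ℝ) (hb : 0 < b) (hM : b ≤ M) (hv0 : ∀ j, 0 ≤ v j)
    (hv : ∀ j, v j ≤ M) (N n : ℕ) (p : ℕ → Prop) [DecidablePred p]
    (hN : #{j ∈ range n | p j} ≤ N) (hp : ∀ j, ¬ p j → v j ≤ b) :
    ∏ j ∈ range n, v j ≤ (M / b) ^ N * b ^ n := by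
  calc ∏ j ∈ range n, v j ≤ ∏ j ∈ range n, ((if p j then M / b else 1) * b) := by
        refine Finset.prod_le_prod (fun i _ => hv0 i) fun i _ => ?_
        split_ifs with h
        · rw [div_mul_cancel₀ _ hb.ne']; exact hv i
        · simpa using hp i h
    _ = (M / b) ^ #{j ∈ range n | p j} * b ^ n := by
        rw [Finset.prod_mul_distrib, Finset.prod_ite]; simp [div_pow]
    _ ≤ _ := by
        gcongr
        exact (one_le_div hb).2 hM

lemma prod_lower (v : ℕ → ℝ) (m b : ℝ) (hm : 0 < m) (hM : m ≤ b)
    (hv : ∀ j, m ≤ v j) (N n : ℕ) (p : ℕ → Prop) [DecidablePred p]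
    (hN : #{j ∈ range n | p j} ≤ N) (hp : ∀ j, ¬ p j → b ≤ v j) :
    (m / b) ^ N * b ^ n ≤ ∏ j ∈ range n, v j := by
  have hb : 0 < b := hm.trans_le hM
  calc (m / b) ^ N * b ^ n ≤ (m / b) ^ #{j ∈ range n | p j} * b ^ n := by
        gcongr ?_ * _
        exact pow_le_pow_of_le_one (by positivity) ((div_le_one hb).2 hM) hN
    _ = ∏ j ∈ range n, ((if p j then m / b else 1) * b) := by
        rw [Finset.prod_mul_distrib, Finset.prod_ite]; simp [div_pow]
    _ ≤ _ := by
        refine Finset.prod_le_prod (fun i _ => by split_ifs <;> positivity) fun i _ => ?_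
        split_ifs with h
        · rw [div_mul_cancel₀ _ hb.ne']; exact hv i
        · simpa using hp i h

lemma auto_facts (φ : ℂ → ℂ) (a : ℂ) (hp : IsParabolicAuto φ a) :
    (∀ z ∈ D1, φ z ∈ D1) ∧ (∀ z ∈ D1, DifferentiableAt ℂ φ z) ∧
    (∀ z ∈ D1, (1 - ‖z‖ ^ 2) * ‖deriv φ z‖ = 1 - ‖φ z‖ ^ 2) ∧
    (∃ c : ℝ, 0 < c ∧ c ≤ 1 ∧ ∀ z ∈ D1, c * (1 - ‖z‖ ^ 2) ≤ 1 - ‖φ z‖ ^ 2) ∧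
    (∃ c : ℂ, c ≠ 0 ∧ ∀ z ∈ D1, (φ z - a)⁻¹ = (z - a)⁻¹ + c) := by
  obtain ⟨⟨lam, α, hlam, hα, hφ⟩, ha, hfa, hda, huniq⟩ := hp
  have hφe : φ = fun z => lam * (α - z) / (1 - (starRingEnd ℂ) α * z) := funext hφ
  have hα1 : ‖α‖ < 1 := by simpa [D1] using hα
  have hden : ∀ z : ℂ, ‖z‖ ≤ 1 → 1 - (starRingEnd ℂ) α * z ≠ 0 := by
    intro z hz h
    have h1 : (starRingEnd ℂ) α * z = 1 := (sub_eq_zero.1 h).symm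
    have h2 : ‖(starRingEnd ℂ) α * z‖ = 1 := by rw [h1]; simp
    rw [norm_mul, RCLike.norm_conj] at h2
    nlinarith [norm_nonneg α, norm_nonneg z]
  have hder : ∀ z : ℂ, ‖z‖ ≤ 1 → HasDerivAt φ
      (-lam * (1 - (starRingEnd ℂ) α * α) / (1 - (starRingEnd ℂ) α * z) ^ 2) z := by
    intro z hz
    have h1 : HasDerivAt (fun z : ℂ => lam * (α - z)) (lam * (0 - 1)) z :=
      ((hasDerivAt_const z α).sub (hasDerivAt_id z)).const_mul lam
    have h2 : HasDerivAt (fun z : ℂ => 1 - (starRingEnd ℂ) α * z)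
        (0 - (starRingEnd ℂ) α * 1) z :=
      (hasDerivAt_const z (1:ℂ)).sub ((hasDerivAt_id z).const_mul _)
    rw [hφe]
    refine (h1.div h2 (hden z hz)).congr_deriv ?_
    congr 1
    ring
  have hnsq : ∀ z : ℂ, ‖z‖ ≤ 1 → 1 - ‖φ z‖ ^ 2 =
      (1 - ‖α‖ ^ 2) * (1 - ‖z‖ ^ 2) / ‖1 - (starRingEnd ℂ) α * z‖ ^ 2 := by
    intro z hz
    have h0 : ‖1 - (starRingEnd ℂ) α * z‖ ^ 2 ≠ 0 := pow_ne_zero _ (norm_ne_zero_iff.2 (hden z hz))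
    rw [hφ z, norm_div, norm_mul, hlam, one_mul, div_pow, eq_div_iff h0, sub_mul,
      div_mul_cancel₀ _ h0]
    simp only [← Complex.normSq_eq_norm_sq, Complex.normSq_apply, Complex.sub_re, Complex.sub_im,
      Complex.mul_re, Complex.mul_im, Complex.conj_re, Complex.conj_im, Complex.one_re,
      Complex.one_im]
    ring
  have hαpos : 0 < 1 - ‖α‖ ^ 2 := by nlinarith [norm_nonneg α]
  have hzpos : ∀ z ∈ D1, 0 < 1 - ‖z‖ ^ 2 := by
    intro z hz
    have : ‖z‖ < 1 := by simpa [D1] using hz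
    nlinarith [norm_nonneg z]
  have hle : ∀ z ∈ D1, ‖z‖ ≤ 1 := by
    intro z hz
    have : ‖z‖ < 1 := by simpa [D1] using hz
    exact this.le
  have hcc : ‖1 - (starRingEnd ℂ) α * α‖ = 1 - ‖α‖ ^ 2 := by
    have : (1 : ℂ) - (starRingEnd ℂ) α * α = ((1 - ‖α‖ ^ 2 : ℝ) : ℂ) := by
      rw [mul_comm, Complex.mul_conj, Complex.normSq_eq_norm_sq]; push_cast; ring
    rw [this, Complex.norm_real, Real.norm_of_nonneg hαpos.le]
  refine ⟨?_, fun z hz => (hder z (hle z hz)).differentiableAt, ?_, ?_, ?_⟩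
  · intro z hz
    have h0 : 0 < ‖1 - (starRingEnd ℂ) α * z‖ := norm_pos_iff.2 (hden z (hle z hz))
    have : 0 < 1 - ‖φ z‖ ^ 2 := by
      rw [hnsq z (hle z hz)]
      have := hzpos z hz
      positivity
    have : ‖φ z‖ < 1 := by nlinarith [norm_nonneg (φ z)]
    simpa [D1] using this
  · intro z hz
    rw [(hder z (hle z hz)).deriv, hnsq z (hle z hz), norm_div, norm_mul, norm_neg, hlam, hcc,
      norm_pow]
    ring
  · refine ⟨(1 - ‖α‖ ^ 2) / 4, by positivity, by nlinarith [norm_nonneg α], ?_⟩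
    intro z hz
    have h0 : 0 < ‖1 - (starRingEnd ℂ) α * z‖ := norm_pos_iff.2 (hden z (hle z hz))
    have h1 : ‖1 - (starRingEnd ℂ) α * z‖ ≤ 2 := by
      have := norm_sub_le 1 ((starRingEnd ℂ) α * z)
      rw [norm_mul, RCLike.norm_conj, norm_one] at this
      nlinarith [norm_nonneg α, norm_nonneg z, hle z hz]
    have h2 := hzpos z hz
    rw [hnsq z (hle z hz), div_mul_eq_mul_div]
    apply div_le_div_of_nonneg_left (by positivity) (by positivity)
    nlinarith
  · have hda' := (hder a ha.le).deriv
    rw [hda] at hda'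
    have hna := hden a ha.le
    have hα0 : α ≠ 0 := by
      rintro rfl
      have h0 : φ 0 = 0 := by rw [hφ]; simp
      have := huniq 0 (by simp) h0
      rw [← this] at ha
      simp at ha
    refine ⟨-(starRingEnd ℂ) α / (1 - (starRingEnd ℂ) α * a), ?_, ?_⟩
    · exact div_ne_zero (neg_ne_zero.2 (by simpa using hα0)) hna
    · intro z hz
      have hnz := hden z (hle z hz)
      have hza : z - a ≠ 0 := by
        intro h
        rw [sub_eq_zero.1 h] at hz
        have := hzpos a hz
        rw [ha] at this
        norm_num at this
      have key : φ z - a = (z - a) * (1 - (starRingEnd ℂ) α * a) / (1 - (starRingEnd ℂ) α * z) := by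
        have e1 : lam * (α - a) / (1 - (starRingEnd ℂ) α * a) = a := by rw [← hφ a]; exact hfa
        rw [eq_div_iff (pow_ne_zero 2 hna), one_mul] at hda'
        rw [div_eq_iff hna] at e1
        rw [hφ z, eq_div_iff hnz, sub_mul, div_mul_cancel₀ _ hnz]
        have : (lam * (α - z) - a * (1 - (starRingEnd ℂ) α * z)
            - (z - a) * (1 - (starRingEnd ℂ) α * a)) * (1 - (starRingEnd ℂ) α * a) = 0 := by
          linear_combination (z - a) * (-1) * hda' + (1 - (starRingEnd ℂ) α * z) * e1
        have := (mul_eq_zero.1 this).resolve_right hna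
        linear_combination this
      rw [key]
      generalize (starRingEnd ℂ) α = β at hna hnz
      rw [inv_div, inv_eq_one_div, div_add_div _ _ hza hna,
        div_eq_div_iff (mul_ne_zero hza hna) (mul_ne_zero hza hna)]
      ring

/-- A logarithmic growth weight. -/
def Lw (z : ℂ) : ℝ := 1 - Real.log (1 - ‖z‖ ^ 2)

lemma norm_lt_of_mem {z : ℂ} (hz : z ∈ D1) : ‖z‖ < 1 := by simpa [D1] using hz

lemma pos_of_mem {z : ℂ} (hz : z ∈ D1) : 0 < 1 - ‖z‖ ^ 2 := by
  have := norm_lt_of_mem hz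
  nlinarith [norm_nonneg z]

lemma one_le_Lw {z : ℂ} (hz : z ∈ D1) : 1 ≤ Lw z := by
  have := Real.log_nonpos (pos_of_mem hz).le (by nlinarith [norm_nonneg z])
  unfold Lw; linarith

lemma isOpen_D1 : IsOpen D1 := Metric.isOpen_ball

lemma zero_mem_D1 : (0 : ℂ) ∈ D1 := by simp [D1]

lemma semi_nonneg (f : ℂ → ℂ) : 0 ≤ blochSemi f :=
  Real.iSup_nonneg fun z => mul_nonneg (pos_of_mem z.2).le (norm_nonneg _)

lemma norm_nonneg_bloch (f : ℂ → ℂ) : 0 ≤ blochNorm f :=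
  add_nonneg (norm_nonneg _) (semi_nonneg f)

lemma le_semi {f : ℂ → ℂ} (hf : InBloch f) {z : ℂ} (hz : z ∈ D1) :
    (1 - ‖z‖ ^ 2) * ‖deriv f z‖ ≤ blochSemi f := by
  obtain ⟨C, hC⟩ := hf.2
  exact le_ciSup (f := fun z : D1 => (1 - ‖(z : ℂ)‖ ^ 2) * ‖deriv f (z : ℂ)‖)
    ⟨C, by rintro _ ⟨w, rfl⟩; exact hC w w.2⟩ ⟨z, hz⟩

lemma semi_le {f : ℂ → ℂ} {C : ℝ} (h : ∀ z ∈ D1, (1 - ‖z‖ ^ 2) * ‖deriv f z‖ ≤ C) :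
    blochSemi f ≤ C := by
  have : Nonempty D1 := ⟨⟨0, zero_mem_D1⟩⟩
  exact ciSup_le fun z => h z z.2

lemma diffAt {f : ℂ → ℂ} (hf : AnalyticOnD f) {z : ℂ} (hz : z ∈ D1) : DifferentiableAt ℂ f z :=
  hf.differentiableAt (isOpen_D1.mem_nhds hz)

lemma growth {f : ℂ → ℂ} (hf : InBloch f) {w : ℂ} (hw : w ∈ D1) :
    ‖f w‖ ≤ Lw w * blochNorm f := by
  have hw1 := norm_lt_of_mem hw
  have hmem : ∀ t ∈ Set.Icc (0:ℝ) 1, (t : ℂ) * w ∈ D1 := by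
    intro t ht
    have : ‖(t : ℂ) * w‖ < 1 := by
      rw [norm_mul, Complex.norm_real, Real.norm_of_nonneg ht.1]
      nlinarith [norm_nonneg w, ht.1, ht.2]
    simpa [D1] using this
  have hd : ∀ t ∈ Set.Icc (0:ℝ) 1,
      HasDerivAt (fun s : ℝ => f ((s : ℂ) * w)) (deriv f ((t : ℂ) * w) * w) t := by
    intro t ht
    have h1 : HasDerivAt (fun s : ℂ => s * w) w (t : ℂ) := by
      simpa using (hasDerivAt_id (t : ℂ)).mul_const w
    have h2 := (diffAt hf.1 (hmem t ht)).hasDerivAt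
    exact (HasDerivAt.comp (t : ℂ) h2 h1).comp_ofReal
  have hpos : ∀ t ∈ Set.Icc (0:ℝ) 1, 0 < 1 - t * ‖w‖ := by
    intro t ht
    nlinarith [norm_nonneg w, ht.1, ht.2]
  have hB : ∀ t ∈ Set.Icc (0:ℝ) 1, HasDerivAt
      (fun s : ℝ => ‖f 0‖ + blochSemi f * (-Real.log (1 - s * ‖w‖)))
      (blochSemi f * (‖w‖ / (1 - t * ‖w‖))) t := by
    intro t ht
    have h1 : HasDerivAt (fun s : ℝ => 1 - s * ‖w‖) (-‖w‖) t := by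
      simpa using ((hasDerivAt_id t).mul_const ‖w‖).const_sub 1
    have h2 := (((h1.log (hpos t ht).ne').neg).const_mul (blochSemi f)).const_add ‖f 0‖
    refine h2.congr_deriv ?_
    ring
  have key := image_norm_le_of_norm_deriv_right_le_deriv_boundary'
    (f := fun s : ℝ => f ((s : ℂ) * w)) (a := 0) (b := 1)
    (f' := fun t => deriv f ((t : ℂ) * w) * w)
    (B := fun s : ℝ => ‖f 0‖ + blochSemi f * (-Real.log (1 - s * ‖w‖)))
    (B' := fun t => blochSemi f * (‖w‖ / (1 - t * ‖w‖)))
    (fun t ht => (hd t ht).continuousAt.continuousWithinAt)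
    (fun t ht => (hd t ⟨ht.1, ht.2.le⟩).hasDerivWithinAt)
    (by simp)
    (fun t ht => (hB t ht).continuousAt.continuousWithinAt)
    (fun t ht => (hB t ⟨ht.1, ht.2.le⟩).hasDerivWithinAt)
    (by
      intro t ht
      have ht' : t ∈ Set.Icc (0:ℝ) 1 := ⟨ht.1, ht.2.le⟩
      have h1 := le_semi hf (hmem t ht')
      have h2 := hpos t ht'
      have h3 : ‖(t : ℂ) * w‖ = t * ‖w‖ := by
        rw [norm_mul, Complex.norm_real, Real.norm_of_nonneg ht.1]
      rw [h3] at h1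
      have h4 : (1 - t * ‖w‖) * ‖deriv f ((t : ℂ) * w)‖ ≤ blochSemi f := by
        refine le_trans ?_ h1
        gcongr
        have : 0 ≤ t * ‖w‖ := mul_nonneg ht.1 (norm_nonneg _)
        nlinarith
      rw [norm_mul, ← mul_div_assoc, le_div_iff₀ h2]
      nlinarith [norm_nonneg w])
    (show (1:ℝ) ∈ Set.Icc (0:ℝ) 1 by simp)
  simp only [Complex.ofReal_one, one_mul] at key
  have hlog : -Real.log (1 - ‖w‖) ≤ Lw w := by
    have e : 1 - ‖w‖ ^ 2 = (1 - ‖w‖) * (1 + ‖w‖) := by ring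
    have p1 : 0 < 1 - ‖w‖ := by linarith
    have p2 : 0 < 1 + ‖w‖ := by linarith [norm_nonneg w]
    unfold Lw
    rw [e, Real.log_mul p1.ne' p2.ne']
    have := Real.log_le_sub_one_of_pos p2
    linarith
  have hL := one_le_Lw hw
  unfold blochNorm
  nlinarith [semi_nonneg f, norm_nonneg (f 0), mul_le_mul_of_nonneg_left hlog (semi_nonneg f)]


lemma it_maps {φ : ℂ → ℂ} (H1 : ∀ z ∈ D1, φ z ∈ D1) (n : ℕ) : ∀ z ∈ D1, φ^[n] z ∈ D1 := by
  induction n with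
  | zero => intro z hz; simpa using hz
  | succ n ih => intro z hz; rw [Function.iterate_succ_apply']; exact H1 _ (ih z hz)

lemma it_diff {φ : ℂ → ℂ} (H1 : ∀ z ∈ D1, φ z ∈ D1) (H2 : ∀ z ∈ D1, DifferentiableAt ℂ φ z)
    (n : ℕ) : ∀ z ∈ D1, DifferentiableAt ℂ φ^[n] z := by
  induction n with
  | zero => intro z hz; simp
  | succ n ih =>
    intro z hz
    rw [Function.iterate_succ']
    exact (H2 _ (it_maps H1 n z hz)).comp z (ih z hz)

lemma it_deriv {φ : ℂ → ℂ} (H1 : ∀ z ∈ D1, φ z ∈ D1) (H2 : ∀ z ∈ D1, DifferentiableAt ℂ φ z)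
    (H3 : ∀ z ∈ D1, (1 - ‖z‖ ^ 2) * ‖deriv φ z‖ = 1 - ‖φ z‖ ^ 2)
    (n : ℕ) : ∀ z ∈ D1, (1 - ‖z‖ ^ 2) * ‖deriv φ^[n] z‖ = 1 - ‖φ^[n] z‖ ^ 2 := by
  induction n with
  | zero => intro z hz; simp
  | succ n ih =>
    intro z hz
    have hm := it_maps H1 n z hz
    rw [Function.iterate_succ', deriv_comp z (H2 _ hm) (it_diff H1 H2 n z hz), norm_mul,
      Function.comp_apply, ← H3 _ hm, ← ih z hz]
    ring

lemma it_L {φ : ℂ → ℂ} (H1 : ∀ z ∈ D1, φ z ∈ D1) {c : ℝ} (hc : 0 < c)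
    (H4 : ∀ z ∈ D1, c * (1 - ‖z‖ ^ 2) ≤ 1 - ‖φ z‖ ^ 2) (n : ℕ) :
    ∀ z ∈ D1, Lw (φ^[n] z) ≤ Lw z + n * (-Real.log c) := by
  induction n with
  | zero => intro z hz; simp
  | succ n ih =>
    intro z hz
    have hm := it_maps H1 n z hz
    have h1 := Real.log_le_log (mul_pos hc (pos_of_mem hm)) (H4 _ hm)
    rw [Real.log_mul hc.ne' (pos_of_mem hm).ne'] at h1
    have h2 := ih z hz
    rw [Function.iterate_succ_apply']
    unfold Lw at h2 ⊢
    push_cast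
    linarith

lemma wprod_succ (u φ : ℂ → ℂ) (n : ℕ) :
    wprod u φ (n + 1) = fun z => wprod u φ n z * u (φ^[n] z) := by
  funext z; simp [wprod, Finset.prod_range_succ]

lemma wco_iter (u φ : ℂ → ℂ) (n : ℕ) : ∀ f : ℂ → ℂ,
    (wco u φ)^[n] f = fun z => wprod u φ n z * f (φ^[n] z) := by
  induction n with
  | zero => intro f; funext z; simp [wprod]
  | succ n ih =>
    intro f
    rw [Function.iterate_succ_apply, ih, wprod_succ]
    funext z
    simp only [wco, Function.iterate_succ_apply']
    ring

lemma comp_deriv_bound {φ f : ℂ → ℂ} (H1 : ∀ z ∈ D1, φ z ∈ D1)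
    (H2 : ∀ z ∈ D1, DifferentiableAt ℂ φ z)
    (H3 : ∀ z ∈ D1, (1 - ‖z‖ ^ 2) * ‖deriv φ z‖ = 1 - ‖φ z‖ ^ 2) (hf : AnalyticOnD f)
    {z : ℂ} (hz : z ∈ D1) (n : ℕ) :
    DifferentiableAt ℂ (fun z => f (φ^[n] z)) z ∧ (1 - ‖z‖ ^ 2) * ‖deriv (fun z => f (φ^[n] z)) z‖
      = (1 - ‖φ^[n] z‖ ^ 2) * ‖deriv f (φ^[n] z)‖ := by
  have hm := it_maps H1 n z hz
  have d1 := diffAt hf hm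
  have d2 := it_diff H1 H2 n z hz
  refine ⟨d1.comp z d2, ?_⟩
  have : deriv (fun z => f (φ^[n] z)) z = deriv f (φ^[n] z) * deriv φ^[n] z := deriv_comp z d1 d2
  rw [this, norm_mul, ← it_deriv H1 H2 H3 n z hz]
  ring

lemma wprod_deriv {u φ : ℂ → ℂ} (H1 : ∀ z ∈ D1, φ z ∈ D1)
    (H2 : ∀ z ∈ D1, DifferentiableAt ℂ φ z)
    (H3 : ∀ z ∈ D1, (1 - ‖z‖ ^ 2) * ‖deriv φ z‖ = 1 - ‖φ z‖ ^ 2) (hu : AnalyticOnD u)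
    {δ : ℝ} (hδ : 0 < δ) (hb : ∀ z ∈ D1, δ ≤ ‖u z‖) {z : ℂ} (hz : z ∈ D1) (n : ℕ) :
    DifferentiableAt ℂ (wprod u φ n) z ∧ (1 - ‖z‖ ^ 2) * ‖deriv (wprod u φ n) z‖ ≤
      ‖wprod u φ n z‖ *
        ∑ j ∈ range n, (1 - ‖φ^[j] z‖ ^ 2) * ‖deriv u (φ^[j] z)‖ / δ := by
  induction n with
  | zero =>
    have : wprod u φ 0 = fun _ => 1 := by funext z; simp [wprod]
    rw [this]; simp
  | succ n ih =>
    obtain ⟨d, hd⟩ := ih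
    obtain ⟨e, he⟩ := comp_deriv_bound H1 H2 H3 hu hz n
    rw [wprod_succ]
    refine ⟨d.mul e, ?_⟩
    have hder : deriv (fun z => wprod u φ n z * u (φ^[n] z)) z =
      deriv (wprod u φ n) z * u (φ^[n] z) + wprod u φ n z * deriv (fun z => u (φ^[n] z)) z :=
      deriv_fun_mul d e
    have hp := pos_of_mem hz
    have hm := it_maps H1 n z hz
    have hq := pos_of_mem hm
    have hbb := hb _ hm
    rw [hder, Finset.sum_range_succ, norm_mul]
    set S := ∑ j ∈ range n, (1 - ‖φ^[j] z‖ ^ 2) * ‖deriv u (φ^[j] z)‖ / δ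
    set E := (1 - ‖φ^[n] z‖ ^ 2) * ‖deriv u (φ^[n] z)‖ with hE
    have hE0 : 0 ≤ E := by positivity
    calc _ ≤ (1 - ‖z‖ ^ 2) * (‖deriv (wprod u φ n) z‖ * ‖u (φ^[n] z)‖ +
          ‖wprod u φ n z‖ * ‖deriv (fun z => u (φ^[n] z)) z‖) := by
          gcongr
          refine (norm_add_le _ _).trans ?_
          rw [norm_mul, norm_mul]
      _ = ((1 - ‖z‖ ^ 2) * ‖deriv (wprod u φ n) z‖) * ‖u (φ^[n] z)‖ + ‖wprod u φ n z‖ * E := by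
          rw [← he]; ring
      _ ≤ (‖wprod u φ n z‖ * S) * ‖u (φ^[n] z)‖ + ‖wprod u φ n z‖ * (‖u (φ^[n] z)‖ * (E / δ)) := by
          gcongr
          rw [mul_div_assoc', le_div_iff₀ hδ]
          nlinarith
      _ = _ := by ring

lemma one_inBloch : InBloch (fun _ => (1 : ℂ)) :=
  ⟨differentiableOn_const _, 0, by intro z hz; simp⟩

lemma one_bloch : blochNorm (fun _ => (1 : ℂ)) = 1 := by
  simp [blochNorm, blochSemi]

lemma testfun {w : ℂ} (hw : w ∈ D1) :
    InBloch (fun z => Complex.log (1 - (starRingEnd ℂ) w * z)) ∧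
    blochNorm (fun z => Complex.log (1 - (starRingEnd ℂ) w * z)) ≤ 2 := by
  have hw1 := norm_lt_of_mem hw
  have hsm : ∀ z ∈ D1, ‖(starRingEnd ℂ) w * z‖ ≤ ‖z‖ := by
    intro z hz
    rw [norm_mul, RCLike.norm_conj]
    nlinarith [norm_nonneg z]
  have hd : ∀ z ∈ D1, HasDerivAt (fun z => Complex.log (1 - (starRingEnd ℂ) w * z))
      (-(starRingEnd ℂ) w / (1 - (starRingEnd ℂ) w * z)) z := by
    intro z hz
    have h1 : HasDerivAt (fun z : ℂ => 1 - (starRingEnd ℂ) w * z) (-(starRingEnd ℂ) w) z := by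
      simpa using ((hasDerivAt_id z).const_mul ((starRingEnd ℂ) w)).const_sub 1
    refine h1.clog ?_
    have := Complex.mem_slitPlane_of_norm_lt_one (z := -((starRingEnd ℂ) w * z))
      (by rw [norm_neg]; exact (hsm z hz).trans_lt (norm_lt_of_mem hz))
    simpa [sub_eq_add_neg] using this
  have hbd : ∀ z ∈ D1, (1 - ‖z‖ ^ 2) *
      ‖deriv (fun z => Complex.log (1 - (starRingEnd ℂ) w * z)) z‖ ≤ 2 := by
    intro z hz
    have hz1 := norm_lt_of_mem hz
    rw [(hd z hz).deriv, norm_div, norm_neg, RCLike.norm_conj]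
    have h1 : 1 - ‖z‖ ≤ ‖1 - (starRingEnd ℂ) w * z‖ := by
      have := norm_sub_norm_le 1 ((starRingEnd ℂ) w * z)
      rw [norm_one] at this
      linarith [hsm z hz]
    have h2 : 0 < ‖1 - (starRingEnd ℂ) w * z‖ := by linarith
    rw [← mul_div_assoc, div_le_iff₀ h2]
    have h3 : (1 - ‖z‖ ^ 2) * ‖w‖ ≤ (1 - ‖z‖ ^ 2) * 1 :=
      mul_le_mul_of_nonneg_left hw1.le (pos_of_mem hz).le
    nlinarith [norm_nonneg z]
  refine ⟨⟨fun z hz => (hd z hz).differentiableAt.differentiableWithinAt, 2, hbd⟩, ?_⟩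
  have := semi_le hbd
  unfold blochNorm
  simpa using this

lemma mult_bound {u φ : ℂ → ℂ} (H1 : ∀ z ∈ D1, φ z ∈ D1)
    (H2 : ∀ z ∈ D1, DifferentiableAt ℂ φ z)
    (H3 : ∀ z ∈ D1, (1 - ‖z‖ ^ 2) * ‖deriv φ z‖ = 1 - ‖φ z‖ ^ 2) (hu : AnalyticOnD u)
    {M : ℝ} (hM : ∀ z ∈ D1, ‖u z‖ ≤ M) (hT : BddOnBloch (wco u φ)) :
    ∃ K : ℝ, 0 ≤ K ∧ ∀ z ∈ D1, (1 - ‖z‖ ^ 2) * ‖deriv u z‖ * Lw (φ z) ≤ K := by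
  obtain ⟨C, hC⟩ := hT
  have hM0 : 0 ≤ M := (norm_nonneg _).trans (hM 0 zero_mem_D1)
  have key : ∀ f, InBloch f → ∀ z ∈ D1,
      (1 - ‖z‖ ^ 2) * ‖deriv u z‖ * ‖f (φ z)‖ ≤ (|C| + M) * blochNorm f := by
    intro f hf z hz
    obtain ⟨h1, h2⟩ := hC f hf
    have h3 := le_semi h1 hz
    obtain ⟨e, he⟩ := comp_deriv_bound H1 H2 H3 hf.1 hz 1
    simp only [Function.iterate_one] at e he
    have hder : deriv (wco u φ f) z = deriv u z * f (φ z) + u z * deriv (fun z => f (φ z)) z :=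
      deriv_fun_mul (diffAt hu hz) e
    have h4 : deriv u z * f (φ z) = deriv (wco u φ f) z - u z * deriv (fun z => f (φ z)) z := by
      rw [hder]; ring
    have hp := pos_of_mem hz
    have h5 : blochSemi (wco u φ f) ≤ |C| * blochNorm f := by
      have : blochSemi (wco u φ f) ≤ blochNorm (wco u φ f) := by
        unfold blochNorm; linarith [norm_nonneg (wco u φ f 0)]
      have h6 := mul_le_mul_of_nonneg_right (le_abs_self C) (norm_nonneg_bloch f)
      linarith
    have h6 : blochSemi f ≤ blochNorm f := by
      unfold blochNorm; linarith [norm_nonneg (f 0)]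
    have h7 := (le_semi hf (H1 z hz)).trans h6
    calc _ = (1 - ‖z‖ ^ 2) * ‖deriv u z * f (φ z)‖ := by rw [norm_mul]; ring
      _ ≤ (1 - ‖z‖ ^ 2) * (‖deriv (wco u φ f) z‖ + ‖u z‖ * ‖deriv (fun z => f (φ z)) z‖) := by
        rw [h4, ← norm_mul]
        gcongr
        exact norm_sub_le _ _
      _ = (1 - ‖z‖ ^ 2) * ‖deriv (wco u φ f) z‖ +
          ‖u z‖ * ((1 - ‖φ z‖ ^ 2) * ‖deriv f (φ z)‖) := by rw [← he]; ring
      _ ≤ |C| * blochNorm f + M * blochNorm f := by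
        refine add_le_add (h3.trans h5) (mul_le_mul (hM z hz) h7 ?_ hM0)
        exact mul_nonneg (pos_of_mem (H1 z hz)).le (norm_nonneg _)
      _ = _ := by ring
  refine ⟨3 * (|C| + M), by positivity, ?_⟩
  intro z hz
  have hw := H1 z hz
  have k1 := key _ one_inBloch z hz
  rw [one_bloch] at k1
  obtain ⟨t1, t2⟩ := testfun hw
  have k2 := key _ t1 z hz
  have hval : Lw (φ z) - 1 ≤ ‖Complex.log (1 - (starRingEnd ℂ) (φ z) * φ z)‖ := by
    have : (1 : ℂ) - (starRingEnd ℂ) (φ z) * φ z = ((1 - ‖φ z‖ ^ 2 : ℝ) : ℂ) := by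
      rw [mul_comm, Complex.mul_conj, Complex.normSq_eq_norm_sq]; push_cast; ring
    rw [this, ← Complex.ofReal_log (pos_of_mem hw).le, Complex.norm_real, Real.norm_eq_abs]
    unfold Lw
    have := neg_abs_le (Real.log (1 - ‖φ z‖ ^ 2))
    linarith
  have hq : 0 ≤ (1 - ‖z‖ ^ 2) * ‖deriv u z‖ := mul_nonneg (pos_of_mem hz).le (norm_nonneg _)
  have k3 := mul_le_mul_of_nonneg_left hval hq
  have k4 := mul_le_mul_of_nonneg_left t2 (show 0 ≤ |C| + M by positivity)
  simp only [norm_one] at k1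
  linarith

lemma sum_bound {u φ : ℂ → ℂ} (H1 : ∀ z ∈ D1, φ z ∈ D1) {c : ℝ} (hc : 0 < c) (hc1 : c ≤ 1)
    (H4 : ∀ z ∈ D1, c * (1 - ‖z‖ ^ 2) ≤ 1 - ‖φ z‖ ^ 2) {δ : ℝ} (hδ : 0 < δ) {Q : ℝ}
    (hQ : ∀ z ∈ D1, (1 - ‖z‖ ^ 2) * ‖deriv u z‖ * Lw (φ z) ≤ Q)
    {z : ℂ} (hz : z ∈ D1) (n : ℕ) :
    (∑ j ∈ range n, (1 - ‖φ^[j] z‖ ^ 2) * ‖deriv u (φ^[j] z)‖ / δ) * Lw (φ^[n] z) ≤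
      n * (Q / δ * (1 + n * (-Real.log c))) := by
  have hK : 0 ≤ -Real.log c := by linarith [Real.log_nonpos hc.le hc1]
  rw [Finset.sum_mul]
  have : ∀ j ∈ range n, (1 - ‖φ^[j] z‖ ^ 2) * ‖deriv u (φ^[j] z)‖ / δ * Lw (φ^[n] z) ≤
      Q / δ * (1 + n * (-Real.log c)) := by
    intro j hj
    have hjn : j < n := Finset.mem_range.1 hj
    have hw := it_maps H1 j z hz
    have hw' := H1 _ hw
    have e : φ^[n] z = φ^[n - 1 - j] (φ (φ^[j] z)) := by
      rw [← Function.iterate_succ_apply' φ j z, ← Function.iterate_add_apply]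
      congr 2
      omega
    have h1 := it_L H1 hc H4 (n - 1 - j) _ hw'
    rw [← e] at h1
    have h2 : ((n - 1 - j : ℕ) : ℝ) ≤ n := by exact_mod_cast (by omega : n - 1 - j ≤ n)
    have h3 := one_le_Lw hw'
    have h4 : Lw (φ^[n] z) ≤ Lw (φ (φ^[j] z)) * (1 + n * (-Real.log c)) := by
      have a1 := mul_le_mul_of_nonneg_right h2 hK
      have a2 : 0 ≤ (n : ℝ) * (-Real.log c) := by positivity
      nlinarith
    have hq : 0 ≤ (1 - ‖φ^[j] z‖ ^ 2) * ‖deriv u (φ^[j] z)‖ :=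
      mul_nonneg (pos_of_mem hw).le (norm_nonneg _)
    have h5 : 0 ≤ 1 + (n : ℝ) * (-Real.log c) := by positivity
    rw [div_mul_eq_mul_div, div_mul_eq_mul_div]
    refine div_le_div_of_nonneg_right ?_ hδ.le
    calc _ ≤ (1 - ‖φ^[j] z‖ ^ 2) * ‖deriv u (φ^[j] z)‖ *
            (Lw (φ (φ^[j] z)) * (1 + n * (-Real.log c))) := by gcongr
      _ = ((1 - ‖φ^[j] z‖ ^ 2) * ‖deriv u (φ^[j] z)‖ * Lw (φ (φ^[j] z))) *
            (1 + n * (-Real.log c)) := by ring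
      _ ≤ _ := mul_le_mul_of_nonneg_right (hQ _ hw) h5
  refine (Finset.sum_le_sum this).trans ?_
  simp

lemma op_bound {u φ : ℂ → ℂ} (H1 : ∀ z ∈ D1, φ z ∈ D1)
    (H2 : ∀ z ∈ D1, DifferentiableAt ℂ φ z)
    (H3 : ∀ z ∈ D1, (1 - ‖z‖ ^ 2) * ‖deriv φ z‖ = 1 - ‖φ z‖ ^ 2) (hu : AnalyticOnD u)
    {c : ℝ} (hc : 0 < c) (hc1 : c ≤ 1)
    (H4 : ∀ z ∈ D1, c * (1 - ‖z‖ ^ 2) ≤ 1 - ‖φ z‖ ^ 2) {δ : ℝ} (hδ : 0 < δ)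
    (hb : ∀ z ∈ D1, δ ≤ ‖u z‖) {Q : ℝ} (hQ0 : 0 ≤ Q)
    (hQ : ∀ z ∈ D1, (1 - ‖z‖ ^ 2) * ‖deriv u z‖ * Lw (φ z) ≤ Q)
    (n : ℕ) (W : ℝ) (hW : ∀ z ∈ D1, ‖wprod u φ n z‖ ≤ W) (f : ℂ → ℂ) (hf : InBloch f) :
    blochNorm ((wco u φ)^[n] f) ≤
      (W * ((1 - Real.log c) * (2 + Q / δ) * ((n : ℝ) + 1) ^ 2)) * blochNorm f := by
  have hK : 0 ≤ -Real.log c := by linarith [Real.log_nonpos hc.le hc1]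
  have hW0 : 0 ≤ W := (norm_nonneg _).trans (hW 0 zero_mem_D1)
  have hF := norm_nonneg_bloch f
  rw [wco_iter]
  have h0 : ‖wprod u φ n 0 * f (φ^[n] 0)‖ ≤ W * ((1 + n * (-Real.log c)) * blochNorm f) := by
    have hm := it_maps H1 n 0 zero_mem_D1
    have h1 := it_L H1 hc H4 n 0 zero_mem_D1
    have h2 : Lw 0 = 1 := by simp [Lw]
    rw [h2] at h1
    rw [norm_mul]
    refine mul_le_mul (hW 0 zero_mem_D1) ((growth hf hm).trans ?_) (norm_nonneg _) hW0
    gcongr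
  have hs : blochSemi (fun z => wprod u φ n z * f (φ^[n] z)) ≤
      W * ((n * (Q / δ * (1 + n * (-Real.log c))) + 1) * blochNorm f) := by
    refine semi_le ?_
    intro z hz
    obtain ⟨d, hd⟩ := wprod_deriv H1 H2 H3 hu hδ hb hz n
    obtain ⟨e, he⟩ := comp_deriv_bound H1 H2 H3 hf.1 hz n
    have hder : deriv (fun z => wprod u φ n z * f (φ^[n] z)) z =
      deriv (wprod u φ n) z * f (φ^[n] z) + wprod u φ n z * deriv (fun z => f (φ^[n] z)) z :=
      deriv_fun_mul d e
    have hm := it_maps H1 n z hz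
    have hp := pos_of_mem hz
    have hsum := sum_bound H1 hc hc1 H4 hδ hQ hz n
    set S := ∑ j ∈ range n, (1 - ‖φ^[j] z‖ ^ 2) * ‖deriv u (φ^[j] z)‖ / δ with hS
    have hS0 : 0 ≤ S := Finset.sum_nonneg fun j _ =>
      div_nonneg (mul_nonneg (pos_of_mem (it_maps H1 j z hz)).le (norm_nonneg _)) hδ.le
    have hg := growth hf hm
    have h6 : blochSemi f ≤ blochNorm f := by
      unfold blochNorm; linarith [norm_nonneg (f 0)]
    have h7 := (le_semi hf hm).trans h6
    have hL := one_le_Lw hm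
    rw [hder]
    calc _ ≤ (1 - ‖z‖ ^ 2) * (‖deriv (wprod u φ n) z‖ * ‖f (φ^[n] z)‖ +
          ‖wprod u φ n z‖ * ‖deriv (fun z => f (φ^[n] z)) z‖) := by
          gcongr
          refine (norm_add_le _ _).trans ?_
          rw [norm_mul, norm_mul]
      _ = ((1 - ‖z‖ ^ 2) * ‖deriv (wprod u φ n) z‖) * ‖f (φ^[n] z)‖ +
          ‖wprod u φ n z‖ * ((1 - ‖φ^[n] z‖ ^ 2) * ‖deriv f (φ^[n] z)‖) := by
          rw [← he]; ring
      _ ≤ (‖wprod u φ n z‖ * S) * (Lw (φ^[n] z) * blochNorm f) +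
          ‖wprod u φ n z‖ * blochNorm f := by
          gcongr
      _ = ‖wprod u φ n z‖ * ((S * Lw (φ^[n] z) + 1) * blochNorm f) := by ring
      _ ≤ _ := by
          have : 0 ≤ S * Lw (φ^[n] z) := mul_nonneg hS0 (by linarith)
          refine mul_le_mul (hW z hz) ?_ (by positivity) hW0
          gcongr
  have hn : (0:ℝ) ≤ n := Nat.cast_nonneg n
  have e1 : (1:ℝ) - Real.log c = 1 + -Real.log c := by ring
  rw [e1]
  have hq : 0 ≤ Q / δ := by positivity
  generalize -Real.log c = K at hK h0 hs
  generalize Q / δ = q at hq hs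
  have hm : (1 + n * K) + (n * (q * (1 + n * K)) + 1) ≤ (1 + K) * (2 + q) * ((n : ℝ) + 1) ^ 2 := by
    have k1 : 1 + n * K ≤ (1 + K) * ((n : ℝ) + 1) := by nlinarith
    have k2 : (1 + K) * ((n : ℝ) + 1) ≤ (1 + K) * ((n : ℝ) + 1) ^ 2 := by
      refine mul_le_mul_of_nonneg_left ?_ (by linarith)
      nlinarith
    have k3 : 1 ≤ (1 + K) * ((n : ℝ) + 1) ^ 2 := by
      have : 0 ≤ (n : ℝ) * K := by positivity
      linarith
    have k4 : (n : ℝ) * (q * (1 + n * K)) ≤ (n + 1) * (q * ((1 + K) * ((n : ℝ) + 1))) := by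
      gcongr
      linarith
    nlinarith
  calc _ ≤ W * ((1 + n * K) * blochNorm f) + W * ((n * (q * (1 + n * K)) + 1) * blochNorm f) :=
        add_le_add h0 hs
    _ = W * ((1 + n * K) + (n * (q * (1 + n * K)) + 1)) * blochNorm f := by ring
    _ ≤ _ := by gcongr

lemma orbit_inv {φ : ℂ → ℂ} {a c : ℂ} (H1 : ∀ z ∈ D1, φ z ∈ D1)
    (H5 : ∀ z ∈ D1, (φ z - a)⁻¹ = (z - a)⁻¹ + c) (n : ℕ) :
    ∀ z ∈ D1, (φ^[n] z - a)⁻¹ = (z - a)⁻¹ + n * c := by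
  induction n with
  | zero => intro z hz; simp
  | succ n ih =>
    intro z hz
    rw [Function.iterate_succ_apply', H5 _ (it_maps H1 n z hz), ih z hz]
    push_cast; ring

/-- spectral radius of uC_φ on B, parabolic case, equals |u(a)|. -/
theorem stmt_14 (u φ : ℂ → ℂ) (a : ℂ) (hu : InDiscAlgebra u)
    (hb : BoundedAwayFromZero u) (hp : IsParabolicAuto φ a)
    (hinv : InvertibleOnBloch (wco u φ)) :
    Filter.Tendsto (fun n : ℕ => opNormB ((wco u φ)^[n]) ^ ((1 : ℝ) / n))
      Filter.atTop (nhds ‖u a‖) := by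
  obtain ⟨H1, H2, H3, ⟨c, hc, hc1, H4⟩, ⟨c', hc', H5⟩⟩ := auto_facts φ a hp
  have ha : ‖a‖ = 1 := hp.2.1
  obtain ⟨δ, hδ, hbd⟩ := hb
  obtain ⟨M, hM'⟩ := (isCompact_closedBall (0:ℂ) 1).exists_bound_of_continuousOn hu.1
  have hM : ∀ z ∈ D1, ‖u z‖ ≤ M := fun z hz => hM' z (Metric.ball_subset_closedBall hz)
  have hac : a ∈ closedBall (0:ℂ) 1 := by simp [ha]
  have hcl : a ∈ closure D1 := by
    unfold D1
    rw [closure_ball _ one_ne_zero]; exact hac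
  have hcont : ContinuousWithinAt u D1 a := (hu.1 a hac).mono Metric.ball_subset_closedBall
  have hs : δ ≤ ‖u a‖ := by
    have : (nhdsWithin a D1).NeBot := mem_closure_iff_nhdsWithin_neBot.1 hcl
    refine ge_of_tendsto (Tendsto.norm hcont) ?_
    filter_upwards [self_mem_nhdsWithin] with z hz using hbd z hz
  obtain ⟨Q, hQ0, hQ⟩ := mult_bound H1 H2 H3 hu.2 hM hinv.1
  have hcount : ∀ ρ > 0, ∃ N : ℕ, ∀ z ∈ D1, ∀ n : ℕ,
      #{j ∈ range n | ρ ≤ ‖φ^[j] z - a‖} ≤ N := by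
    intro ρ hρ
    obtain ⟨N, hN⟩ := exists_nat_gt (2 * ρ⁻¹ / ‖c'‖)
    refine ⟨N, fun z hz n => card_bad ((z - a)⁻¹) c' hc' ρ⁻¹ _ N hN ?_ n⟩
    intro j hj
    rw [← orbit_inv H1 H5 j z hz, norm_inv]
    exact inv_anti₀ hρ hj
  have hWn : ∀ n z, ‖wprod u φ n z‖ = ∏ j ∈ range n, ‖u (φ^[j] z)‖ := by
    intro n z; simp [wprod]
  have hs0 : 0 < ‖u a‖ := hδ.trans_le hs
  have hup : ∀ b, ‖u a‖ < b → ∃ A : ℝ, ∀ n : ℕ, ∀ z ∈ D1, ‖wprod u φ n z‖ ≤ A * b ^ n := by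
    intro b hb
    obtain ⟨ρ, hρ, hball⟩ := Metric.mem_nhdsWithin_iff.1
      ((Tendsto.norm hcont).eventually (gt_mem_nhds hb))
    obtain ⟨N, hN⟩ := hcount ρ hρ
    refine ⟨(max M b / b) ^ N, fun n z hz => ?_⟩
    rw [hWn]
    refine prod_upper _ (max M b) b (hs0.trans hb) (le_max_right _ _) (fun _ => norm_nonneg _)
      (fun j => (hM _ (it_maps H1 j z hz)).trans (le_max_left _ _)) N n _ (hN z hz n) ?_
    intro j hj
    have : φ^[j] z ∈ ball a ρ ∩ D1 := ⟨by simpa [dist_eq_norm] using hj, it_maps H1 j z hz⟩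
    exact le_of_lt (hball this)
  have hlow : ∀ b, 0 < b → b < ‖u a‖ → ∃ A : ℝ, 0 < A ∧ ∀ n : ℕ,
      A * b ^ n ≤ ‖wprod u φ n 0‖ := by
    intro b hb0 hb
    obtain ⟨ρ, hρ, hball⟩ := Metric.mem_nhdsWithin_iff.1
      ((Tendsto.norm hcont).eventually (lt_mem_nhds hb))
    obtain ⟨N, hN⟩ := hcount ρ hρ
    have hmin : 0 < min δ b := lt_min hδ hb0
    refine ⟨(min δ b / b) ^ N, by positivity, fun n => ?_⟩
    rw [hWn]
    refine prod_lower _ (min δ b) b hmin (min_le_right _ _)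
      (fun j => (min_le_left _ _).trans (hbd _ (it_maps H1 j 0 zero_mem_D1))) N n _
      (hN 0 zero_mem_D1 n) ?_
    intro j hj
    have : φ^[j] 0 ∈ ball a ρ ∩ D1 :=
      ⟨by simpa [dist_eq_norm] using hj, it_maps H1 j 0 zero_mem_D1⟩
    exact le_of_lt (hball this)
  have hset : ∀ b, ‖u a‖ < b → ∃ A : ℝ, ∀ n : ℕ,
      (A * ((n : ℝ) + 1) ^ 2 * b ^ n) ∈ {C : ℝ | 0 ≤ C ∧ ∀ f, InBloch f →
        blochNorm ((wco u φ)^[n] f) ≤ C * blochNorm f} := by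
    intro b hb
    obtain ⟨A, hA⟩ := hup b hb
    have hK : 0 ≤ -Real.log c := by linarith [Real.log_nonpos hc.le hc1]
    have hb0 : 0 < b := hs0.trans hb
    have hA0 : 0 ≤ A := by
      have := (norm_nonneg _).trans (hA 0 0 zero_mem_D1)
      simpa using this
    refine ⟨A * ((1 - Real.log c) * (2 + Q / δ)), fun n => ⟨?_, fun f hf => ?_⟩⟩
    · have : 0 ≤ 1 - Real.log c := by linarith
      positivity
    · have := op_bound H1 H2 H3 hu.2 hc hc1 H4 hδ hbd hQ0 hQ n (A * b ^ n) (hA n) f hf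
      refine this.trans (le_of_eq ?_)
      ring
  have hbb : ∀ n, BddBelow {C : ℝ | 0 ≤ C ∧ ∀ f, InBloch f →
        blochNorm ((wco u φ)^[n] f) ≤ C * blochNorm f} := fun n => ⟨0, fun C hC => hC.1⟩
  refine root_tendsto (fun n => opNormB ((wco u φ)^[n])) ‖u a‖ hs0
    (fun n => Real.sInf_nonneg fun C hC => hC.1) ?_ ?_
  · intro b hb
    obtain ⟨A, hA⟩ := hset b hb
    exact ⟨A, fun n => csInf_le (hbb n) (hA n)⟩
  · intro b hb0 hb
    obtain ⟨A, hA0, hA⟩ := hlow b hb0 hb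
    refine ⟨A, hA0, fun n => ?_⟩
    obtain ⟨A', hA'⟩ := hset (‖u a‖ + 1) (by linarith)
    refine le_csInf ⟨_, hA' n⟩ ?_
    rintro C ⟨hC0, hC⟩
    have h1 := hC _ one_inBloch
    rw [one_bloch, mul_one] at h1
    refine (hA n).trans (le_trans ?_ h1)
    have h2 := semi_nonneg ((wco u φ)^[n] fun _ => (1:ℂ))
    unfold blochNorm
    rw [wco_iter] at h2 ⊢
    simpa using h2
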